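/- Let h₁,…,h_d be i.i.d. standard normal and (χ_d⁺)² = ∑_{i=1}^d max(h_i,0)². Then for every x > 0, P((χ_d⁺)² ≤ x) = ∑_{j=0}^{d} (C(d,j)/2^d) · P(j/2, x/2), where P(a,·) is the regularized lower incomplete gamma function with P(0,·) := 1. -/

import Mathlib

open MeasureTheory ProbabilityTheory

/-- Regularized lower incomplete gamma function, with the convention P(0,x) = 1. -/
noncomputable def regIncGamma (a x : ℝ) : ℝ :=
  if a = 0 then 1
  else (∫ t in Set.Ioc (0:ℝ) x, t ^ (a - 1) * Real.exp (-t)) / Real.Gamma a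

open Real Set Filter Topology

lemma integral_gammaMeasure_eq_setIntegral_Ioi {E : Type*} [NormedAddCommGroup E]
    [NormedSpace ℝ E] {a r : ℝ} (ha : 0 < a) (hr : 0 < r) (f : ℝ → E) :
    ∫ x, f x ∂(gammaMeasure a r) =
      ∫ x in Ioi 0, (r ^ a / Gamma a * x ^ (a - 1) * exp (-(r * x))) • f x := by
  have hm : Measurable (gammaPDF a r) := (measurable_gammaPDFReal a r).ennreal_ofReal
  rw [gammaMeasure, integral_withDensity_eq_integral_toReal_smul hm
    (ae_of_all _ fun _ ↦ ENNReal.ofReal_lt_top), ← integral_Ici_eq_integral_Ioi,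
    ← integral_indicator measurableSet_Ici]
  congr with x
  by_cases hx : 0 ≤ x
  · have hp := gammaPDFReal_nonneg ha hr x
    rw [indicator_of_mem (mem_Ici.mpr hx), gammaPDF, ENNReal.toReal_ofReal hp, gammaPDFReal,
      if_pos hx]
  · simp [hx, gammaPDF, gammaPDFReal]

lemma mgf_gammaMeasure {a r t : ℝ} (ha : 0 < a) (hr : 0 < r) (ht : t < r) :
    mgf id (gammaMeasure a r) t = (1 - t / r) ^ (-a) := by
  have hrt : 0 < r - t := sub_pos.mpr ht
  rw [mgf, integral_gammaMeasure_eq_setIntegral_Ioi ha hr]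
  calc ∫ x in Ioi 0, (r ^ a / Gamma a * x ^ (a - 1) * exp (-(r * x))) • exp (t * id x)
      = ∫ x in Ioi 0, r ^ a / Gamma a * (x ^ (a - 1) * exp (-((r - t) * x))) := by
        congr with x
        rw [smul_eq_mul, mul_assoc, ← exp_add, mul_assoc]
        simp only [id]
        ring_nf
    _ = r ^ a * (1 / (r - t)) ^ a := by
        rw [integral_const_mul, integral_rpow_mul_exp_neg_mul_Ioi ha hrt]
        field_simp [(Gamma_pos_of_pos ha).ne']
    _ = (1 - t / r) ^ (-a) := by
        rw [← mul_rpow hr.le (by positivity), rpow_neg_eq_inv_rpow]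
        congr 1
        field_simp

lemma Iio_subset_integrableExpSet_gammaMeasure {a r : ℝ} (ha : 0 < a) (hr : 0 < r) :
    Iio r ⊆ integrableExpSet id (gammaMeasure a r) := by
  intro t (ht : t < r)
  have hpos : 0 < 1 - t / r := by
    rw [sub_pos, div_lt_one hr]
    exact ht
  refine Integrable.of_integral_ne_zero ?_
  change mgf id (gammaMeasure a r) t ≠ 0
  rw [mgf_gammaMeasure ha hr ht]
  exact (rpow_pos_of_pos hpos _).ne'

lemma complexMGF_gammaMeasure {a r : ℝ} {z : ℂ} (ha : 0 < a) (hr : 0 < r) (hz : z.re < r) :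
    complexMGF id (gammaMeasure a r) z = (1 - z / r) ^ (-a : ℂ) := by
  have hsub : Iio r ⊆ interior (integrableExpSet id (gammaMeasure a r)) :=
    isOpen_Iio.subset_interior_iff.mpr (Iio_subset_integrableExpSet_gammaMeasure ha hr)
  have hslit : ∀ w : ℂ, w.re < r → 1 - w / r ∈ Complex.slitPlane := fun w hw ↦ by
    left
    simpa [div_lt_one hr] using hw
  refine AnalyticOnNhd.eqOn_of_preconnected_of_frequently_eq (U := {w : ℂ | w.re < r})
    (f := complexMGF id (gammaMeasure a r)) (g := fun w ↦ (1 - w / r) ^ (-a : ℂ)) (z₀ := 0)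
    (fun w hw ↦ analyticAt_complexMGF (hsub hw)) (fun w hw ↦ ?_)
    (convex_halfSpace_re_lt r).isPreconnected (by simpa using hr) ?_ hz
  · exact AnalyticAt.cpow (by fun_prop) (by fun_prop) (hslit w hw)
  · have hT : Tendsto ((↑) : ℝ → ℂ) (𝓝[≠] 0) (𝓝[≠] 0) := by
      refine tendsto_nhdsWithin_iff.mpr ⟨?_, ?_⟩
      · exact (Complex.continuous_ofReal.tendsto' 0 0 rfl).mono_left nhdsWithin_le_nhds
      · filter_upwards [self_mem_nhdsWithin] with t ht
        simpa using ht
    refine hT.frequently (Eventually.frequently ?_)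
    filter_upwards [nhdsWithin_le_nhds (Iio_mem_nhds hr)] with t ht
    have hpos : 0 ≤ 1 - t / r := by
      rw [sub_nonneg, div_le_one hr]
      exact le_of_lt ht
    rw [complexMGF_ofReal, mgf_gammaMeasure ha hr ht, Complex.ofReal_cpow hpos]
    push_cast
    rfl

lemma charFun_gammaMeasure {a r : ℝ} (ha : 0 < a) (hr : 0 < r) (t : ℝ) :
    charFun (gammaMeasure a r) t = (1 - t * Complex.I / r) ^ (-a : ℂ) := by
  rw [← complexMGF_id_mul_I, complexMGF_gammaMeasure ha hr (by simpa using hr)]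

lemma setIntegral_Ioi_gaussian_complex {w : ℂ} (hw : 0 < w.re) :
    ∫ x : ℝ in Ioi 0, ((√(2 * π))⁻¹ : ℂ) * Complex.exp (-(w / 2) * (x : ℂ) ^ 2) =
      w ^ (-(1 / 2) : ℂ) / 2 := by
  have hw0 : w ≠ 0 := fun h ↦ by simp [h] at hw
  have hpi : (0 : ℝ) < 2 * π := by positivity
  have harg : w.arg ≠ π := Complex.slitPlane_arg_ne_pi (Or.inl hw)
  have hpow : (π / (w / 2) : ℂ) ^ (1 / 2 : ℂ) = √(2 * π) * w ^ (-(1 / 2) : ℂ) := by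
    have hdiv : (π / (w / 2) : ℂ) = ((2 * π : ℝ) : ℂ) * w⁻¹ := by
      push_cast
      field_simp
    have hne : ((2 * π : ℝ) : ℂ) ≠ 0 := Complex.ofReal_ne_zero.mpr hpi.ne'
    rw [hdiv, Complex.cpow_def_of_ne_zero (mul_ne_zero hne (inv_ne_zero hw0)),
      Complex.log_ofReal_mul hpi (inv_ne_zero hw0), add_mul, Complex.exp_add,
      ← Complex.cpow_def_of_ne_zero (inv_ne_zero hw0), Complex.inv_cpow _ _ harg,
      ← Complex.cpow_neg, sqrt_eq_rpow, Complex.ofReal_cpow hpi.le,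
      Complex.cpow_def_of_ne_zero hne, Complex.ofReal_log hpi.le]
    push_cast
    rfl
  have hsq : (√(2 * π) : ℂ) ≠ 0 := by
    exact_mod_cast (sqrt_pos.mpr hpi).ne'
  rw [integral_const_mul, integral_gaussian_complex_Ioi (by simpa using hw), hpow]
  field_simp

lemma charFun_map_max_sq_div_two_gaussianReal (t : ℝ) :
    charFun ((gaussianReal 0 1).map fun x ↦ max x 0 ^ 2 / 2) t =
      (1 + (1 - t * Complex.I) ^ (-(1 / 2) : ℂ)) / 2 := by
  have h_integrable : Integrable (fun x : ℝ ↦ gaussianPDFReal 0 1 x •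
      Complex.exp (t * (max x 0 ^ 2 / 2 : ℝ) * Complex.I)) := by
    refine (integrable_gaussianPDFReal 0 1).smul_bdd 1 (by fun_prop) (ae_of_all _ fun x ↦ ?_)
    rw [← Complex.ofReal_mul, Complex.norm_exp_ofReal_mul_I]
  have hneg : ∫ x in Iic (0 : ℝ), gaussianPDFReal 0 1 x •
      Complex.exp (t * (max x 0 ^ 2 / 2 : ℝ) * Complex.I) = 1 / 2 := by
    have h1 := setIntegral_Ioi_gaussian_complex (w := 1) (by simp)
    rw [Complex.one_cpow, ← neg_zero, ← integral_comp_neg_Iic] at h1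
    rw [← h1]
    refine setIntegral_congr_fun measurableSet_Iic fun x (hx : x ≤ 0) ↦ ?_
    simp only [gaussianPDFReal, max_eq_right hx, Complex.real_smul]
    push_cast
    ring_nf
    simp
  have hpos : ∫ x in Ioi (0 : ℝ), gaussianPDFReal 0 1 x •
      Complex.exp (t * (max x 0 ^ 2 / 2 : ℝ) * Complex.I) =
        (1 - t * Complex.I) ^ (-(1 / 2) : ℂ) / 2 := by
    rw [← setIntegral_Ioi_gaussian_complex (by simp)]
    refine setIntegral_congr_fun measurableSet_Ioi fun x (hx : 0 < x) ↦ ?_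
    simp only [gaussianPDFReal, max_eq_left hx.le, Complex.real_smul]
    push_cast
    rw [mul_assoc, ← Complex.exp_add]
    ring_nf
  rw [charFun_apply_real, integral_map (by fun_prop) (by fun_prop),
    integral_gaussianReal_eq_integral_smul one_ne_zero,
    ← integral_add_compl measurableSet_Iic h_integrable, compl_Iic, hneg, hpos]
  ring

/-- The law of half a chi-squared variable with `j` degrees of freedom. -/
noncomputable def halfChiSq (j : ℕ) : Measure ℝ :=
  if j = 0 then Measure.dirac 0 else gammaMeasure (j / 2) 1

instance isProbabilityMeasure_halfChiSq (j : ℕ) : IsProbabilityMeasure (halfChiSq j) := by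
  unfold halfChiSq
  split_ifs with hj
  · infer_instance
  · exact isProbabilityMeasure_gammaMeasure (by positivity) one_pos

lemma charFun_halfChiSq (j : ℕ) (t : ℝ) :
    charFun (halfChiSq j) t = ((1 - t * Complex.I) ^ (-(1 / 2) : ℂ)) ^ j := by
  unfold halfChiSq
  split_ifs with hj
  · simp [hj]
  · rw [charFun_gammaMeasure (by positivity) one_pos, ← Complex.cpow_nat_mul]
    push_cast
    congr 1
    · simp
    · ring

lemma regIncGamma_nonneg {a : ℝ} (ha : 0 ≤ a) (x : ℝ) : 0 ≤ regIncGamma a x := by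
  unfold regIncGamma
  split_ifs with h
  · exact zero_le_one
  · refine div_nonneg (setIntegral_nonneg measurableSet_Ioc fun t ht ↦ ?_)
      (Gamma_nonneg_of_nonneg ha)
    have := ht.1
    positivity

lemma halfChiSq_Iic (j : ℕ) {x : ℝ} (hx : 0 ≤ x) :
    halfChiSq j (Iic x) = ENNReal.ofReal (regIncGamma (j / 2) x) := by
  by_cases hj : j = 0
  · simp [halfChiSq, hj, regIncGamma, hx]
  have ha : (0 : ℝ) < j / 2 := by positivity
  have : IsProbabilityMeasure (gammaMeasure (j / 2) 1) :=
    isProbabilityMeasure_gammaMeasure ha one_pos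
  rw [halfChiSq, if_neg hj, ← ofReal_measureReal, ← integral_indicator_one measurableSet_Iic,
    integral_gammaMeasure_eq_setIntegral_Ioi ha one_pos, regIncGamma, if_neg ha.ne',
    ← integral_div, ← Ioi_inter_Iic, ← setIntegral_indicator measurableSet_Iic]
  congr 2 with t
  by_cases ht : t ∈ Iic x
  · simp only [indicator_of_mem ht, Pi.one_apply, one_rpow, one_mul, smul_eq_mul]
    ring
  · simp [indicator_of_notMem ht]

lemma map_sum_max_sq_div_two_pi_gaussianReal (d : ℕ) :
    (Measure.pi fun _ : Fin d ↦ gaussianReal 0 1).map (fun h ↦ ∑ i, max (h i) 0 ^ 2 / 2) =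
      ∑ j ∈ Finset.range (d + 1), ENNReal.ofReal ((d.choose j : ℝ) / 2 ^ d) • halfChiSq j := by
  have hfin : ∀ j, IsFiniteMeasure (ENNReal.ofReal ((d.choose j : ℝ) / 2 ^ d) • halfChiSq j) :=
    fun j ↦ Measure.smul_finite _ ENNReal.ofReal_ne_top
  have hind := iIndepFun_pi (μ := fun _ : Fin d ↦ gaussianReal 0 1)
    (X := fun _ x ↦ max x 0 ^ 2 / 2) (fun _ ↦ by fun_prop)
  refine Measure.ext_of_charFun (funext fun t ↦ ?_)
  rw [hind.charFun_map_fun_sum_eq_prod (fun _ ↦ Measurable.aemeasurable (by fun_prop)), Finset.prod_apply]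
  have hmap : ∀ i : Fin d, (Measure.pi fun _ : Fin d ↦ gaussianReal 0 1).map
      (fun h ↦ max (h i) 0 ^ 2 / 2) = (gaussianReal 0 1).map fun x ↦ max x 0 ^ 2 / 2 := fun i ↦ by
    conv_rhs => rw [← (measurePreserving_eval (fun _ : Fin d ↦ gaussianReal 0 1) i).map_eq]
    rw [Measure.map_map (by fun_prop) (by fun_prop)]
    rfl
  simp_rw [hmap, charFun_map_max_sq_div_two_gaussianReal, Finset.prod_const, Finset.card_univ,
    Fintype.card_fin]
  rw [charFun_apply_real, integral_finsetSum_measure, div_pow, add_comm, add_pow, Finset.sum_div]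
  · refine Finset.sum_congr rfl fun j _ ↦ ?_
    rw [integral_smul_measure, ← charFun_apply_real, charFun_halfChiSq,
      ENNReal.toReal_ofReal (by positivity), Complex.real_smul]
    push_cast
    ring
  · intro j _
    refine Integrable.of_bound (by fun_prop) 1 (ae_of_all _ fun x ↦ ?_)
    rw [← Complex.ofReal_mul, Complex.norm_exp_ofReal_mul_I]

/-- CDF of (χ_d⁺)² = ∑ max(h_i,0)² for i.i.d. standard normals:
P((χ_d⁺)² ≤ x) = ∑_{j=0}^d (C(d,j)/2^d) P(j/2, x/2). -/
theorem chiPlus_sq_cdf (d : ℕ) (x : ℝ) (hx : 0 < x) :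
    (Measure.pi fun _ : Fin d => gaussianReal 0 1)
        {h : Fin d → ℝ | ∑ i, max (h i) 0 ^ 2 ≤ x} =
      ENNReal.ofReal
        (∑ j ∈ Finset.range (d + 1),
          ((d.choose j : ℝ) / 2 ^ d) * regIncGamma (j / 2) (x / 2)) := by
  have hset : {h : Fin d → ℝ | ∑ i, max (h i) 0 ^ 2 ≤ x} =
      (fun h : Fin d → ℝ ↦ ∑ i, max (h i) 0 ^ 2 / 2) ⁻¹' Iic (x / 2) := by
    ext h
    simp only [mem_ofPred_eq, mem_preimage, mem_Iic, ← Finset.sum_div]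
    exact (div_le_div_iff_of_pos_right two_pos).symm
  have hnn : ∀ j : ℕ, 0 ≤ regIncGamma (j / 2) (x / 2) := fun j ↦
    regIncGamma_nonneg (by positivity) _
  rw [hset, ← Measure.map_apply (by fun_prop) measurableSet_Iic,
    map_sum_max_sq_div_two_pi_gaussianReal, Measure.finsetSum_apply,
    ENNReal.ofReal_sum_of_nonneg fun j _ ↦ mul_nonneg (by positivity) (hnn j)]
  refine Finset.sum_congr rfl fun j _ ↦ ?_
  rw [Measure.smul_apply, smul_eq_mul, halfChiSq_Iic j (by positivity),
    ENNReal.ofReal_mul (by positivity)]
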